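/- arXiv:1310.3075 — 2 statements merged into one kernel-verified Lean document; each statement's English description precedes it below -/
import Mathlib

section
/- Let X be a locally compact Hausdorff space, h : X → ℝ a continuous function with h(x) > 0 for all x, and (x,y) ↦ μ_{x,y} a family of finite nonnegative compactly supported Borel measures on X such that for every continuous compactly supported f : X → ℂ and every x ∈ X the translate T_x f(y) := ∫_X f dμ_{x,y} is Borel measurable in y. Let ω be a regular Borel measure on X satisfying the conjugation relation ∫_X (T_x f)·g dω = ∫_X (T_x g)·f dω for all continuous compactly supported f,g and all x ∈ X. Define the renormalized kernel μ'_{x,y} := (h(x)h(y))^{−1} · (h·μ_{x,y}), i.e. the measure with density h/(h(x)h(y)) with respect to μ_{x,y}, with translates T'_x f(y) := ∫_X f dμ'_{x,y}. Then the measure ω' := h²·ω (density h² with respect to ω) satisfies the conjugation relation for the renormalized kernel: ∫_X (T'_x f)·g dω' = ∫_X (T'_x g)·f dω' for all continuous compactly supported f,g and all x ∈ X. -/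
open MeasureTheory

lemma integral_withDensity_ofReal_eq_integral_mul {X : Type*} [MeasurableSpace X]
    {φ : X → ℝ} (hφ : Measurable φ) (hφ0 : ∀ x, 0 ≤ φ x) (ν : Measure X) (F : X → ℂ) :
    ∫ z, F z ∂(ν.withDensity fun z => ENNReal.ofReal (φ z)) = ∫ z, (φ z : ℂ) * F z ∂ν := by
  rw [integral_withDensity_eq_integral_toReal_smul hφ.ennreal_ofReal
    (Filter.Eventually.of_forall fun _ => ENNReal.ofReal_lt_top)]
  refine integral_congr_ae (Filter.Eventually.of_forall fun z => ?_)
  simp [ENNReal.toReal_ofReal (hφ0 z)]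

/-- Transfer of the Haar conjugation relation under renormalization of a convolution kernel
by a positive continuous function `h`: if `ω` satisfies the conjugation relation for the
kernel `μ`, then `ω' = h²·ω` satisfies it for the renormalized kernel
`μ'_{x,y} = (h(x)h(y))⁻¹ · (h·μ_{x,y})`. -/
theorem conjugation_relation_renormalized {X : Type*} [TopologicalSpace X]
    [LocallyCompactSpace X] [T2Space X] [MeasurableSpace X] [BorelSpace X]
    (h : X → ℝ) (hct : Continuous h) (hpos : ∀ x, 0 < h x)
    (μ : X → X → Measure X) (hfin : ∀ x y, IsFiniteMeasure (μ x y))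
    (hcpt : ∀ x y, ∃ K : Set X, IsCompact K ∧ μ x y Kᶜ = 0)
    (hmeas : ∀ f : X → ℂ, Continuous f → HasCompactSupport f → ∀ x,
      Measurable fun y => ∫ z, f z ∂μ x y)
    (ω : Measure X) [ω.Regular]
    (hconj : ∀ f g : X → ℂ, Continuous f → HasCompactSupport f →
      Continuous g → HasCompactSupport g → ∀ x,
        ∫ y, (∫ z, f z ∂μ x y) * g y ∂ω = ∫ y, (∫ z, g z ∂μ x y) * f y ∂ω) :
    ∀ f g : X → ℂ, Continuous f → HasCompactSupport f →
      Continuous g → HasCompactSupport g → ∀ x,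
        ∫ y, (∫ z, f z ∂((μ x y).withDensity fun z => ENNReal.ofReal (h z / (h x * h y))))
            * g y ∂(ω.withDensity fun z => ENNReal.ofReal (h z ^ 2)) =
        ∫ y, (∫ z, g z ∂((μ x y).withDensity fun z => ENNReal.ofReal (h z / (h x * h y))))
            * f y ∂(ω.withDensity fun z => ENNReal.ofReal (h z ^ 2)) := by
  intro f g hf hfs hg hgs x
  have hne (y : X) : (h y : ℂ) ≠ 0 := Complex.ofReal_ne_zero.mpr (hpos y).ne'
  have inner_eq (u : X → ℂ) (y : X) :
      ∫ z, u z ∂((μ x y).withDensity fun z => ENNReal.ofReal (h z / (h x * h y))) =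
        ((h x : ℂ) * h y)⁻¹ * ∫ z, (h z : ℂ) * u z ∂μ x y := by
    rw [integral_withDensity_ofReal_eq_integral_mul (hct.measurable.div_const _)
      (fun z => (div_pos (hpos z) (mul_pos (hpos x) (hpos y))).le), ← integral_const_mul]
    congr 1 with z
    push_cast
    ring
  have outer_eq (u v : X → ℂ) :
      ∫ y, (∫ z, u z ∂((μ x y).withDensity fun z => ENNReal.ofReal (h z / (h x * h y))))
          * v y ∂(ω.withDensity fun z => ENNReal.ofReal (h z ^ 2)) =
        (h x : ℂ)⁻¹ * ∫ y, (∫ z, (h z : ℂ) * u z ∂μ x y) * ((h y : ℂ) * v y) ∂ω := by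
    rw [integral_withDensity_ofReal_eq_integral_mul (hct.measurable.pow_const 2)
      (fun z => sq_nonneg _), ← integral_const_mul]
    congr 1 with y
    rw [inner_eq]
    have := hne x
    have := hne y
    push_cast
    field_simp
  have hcℂ : Continuous fun z => (h z : ℂ) := Complex.continuous_ofReal.comp hct
  rw [outer_eq, outer_eq]
  exact congrArg _ (hconj _ _ (hcℂ.mul hf) hfs.mul_left (hcℂ.mul hg) hgs.mul_left x)
end

section
/- Let n ≥ 1 and let G ⊆ ℂⁿ be an open, connected and simply connected set. Let f : ℂⁿ → ℂ be holomorphic on G (complex differentiable at every point of G) with f(x) ≠ 0 for all x ∈ G. Then there exists a function g : ℂⁿ → ℂ holomorphic on G such that f(x) = exp(g(x)) for all x ∈ G; i.e., f admits an analytic logarithm on G. -/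
/-- A continuous logarithm of a complex differentiable function is complex differentiable. -/
theorem DifferentiableAt.of_cexp_comp {E : Type*} [NormedAddCommGroup E] [NormedSpace ℂ E]
    {g : E → ℂ} {x : E} (hg : ContinuousAt g x)
    (hexp : DifferentiableAt ℂ (fun y ↦ Complex.exp (g y)) x) : DifferentiableAt ℂ g x := by
  have hsub : Filter.Tendsto (fun y ↦ (g y - g x).im) (nhds x) (nhds 0) := by
    have h : ContinuousAt (fun y ↦ (g y - g x).im) x :=
      Complex.continuous_im.continuousAt.comp (hg.sub continuousAt_const)
    simpa [ContinuousAt] using h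
  have hlog : DifferentiableAt ℂ
      (fun y ↦ g x + Complex.log (Complex.exp (g y) * (Complex.exp (g x))⁻¹)) x :=
    ((hexp.mul_const _).clog (by simp [Complex.exp_ne_zero])).const_add _
  refine hlog.congr_of_eventuallyEq ?_
  filter_upwards [hsub.eventually (Ioo_mem_nhds (neg_lt_zero.2 Real.pi_pos) Real.pi_pos)]
    with y hy
  rw [← div_eq_mul_inv, ← Complex.exp_sub, Complex.log_exp hy.1 hy.2.le, add_sub_cancel]

/-- A nonvanishing holomorphic function on an open, connected, simply connected subset of
`ℂⁿ` admits a holomorphic logarithm. -/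
theorem exists_holomorphic_log (n : ℕ) (hn : 1 ≤ n) (G : Set (Fin n → ℂ))
    (hGopen : IsOpen G) (hGconn : IsConnected G) (hGsc : SimplyConnectedSpace G)
    (f : (Fin n → ℂ) → ℂ) (hf : DifferentiableOn ℂ f G) (hnz : ∀ x ∈ G, f x ≠ 0) :
    ∃ g : (Fin n → ℂ) → ℂ, DifferentiableOn ℂ g G ∧ ∀ x ∈ G, f x = Complex.exp (g x) := by
  obtain ⟨g, hg, hexp⟩ := Complex.exists_continuousOn_eqOn_exp_comp
    hGsc hGopen hf.continuousOn
    (by rintro ⟨x, hx, h0⟩; exact hnz x hx h0)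
  refine ⟨g, fun x hx ↦ ?_, fun x hx ↦ (hexp hx).symm⟩
  have hG : G ∈ nhds x := hGopen.mem_nhds hx
  exact (DifferentiableAt.of_cexp_comp (hg.continuousAt hG)
    ((hf.differentiableAt hG).congr_of_eventuallyEq
      (hexp.eventuallyEq_of_mem hG))).differentiableWithinAt
end
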